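/- arXiv:2603.12197 — 8 statements merged into one kernel-verified Lean document; each statement's English description precedes it below -/
import Mathlib

section
/- The rewrite relation →_G is strongly normalizing and confluent, and its normal forms (words admitting no →_G step) are exactly the elements of 𝒩 (identifying J_0 with the empty word); consequently every word over 𝒳 ⊔ {J_k : k ∈ ℤ_d} rewrites in finitely many steps to a unique word in 𝒩. -/
/-- Letters: generators from `𝒳 = Fin n` and scalar letters `J k`, `k ∈ ℤ_d`. -/
inductive Letter (n d : ℕ) : Type where
  | gen : Fin n → Letter n d
  | J   : ZMod d → Letter n d

/-- The oriented rewrite rules of the system `→_G`. -/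
inductive GRule (n d : ℕ) (μ : Fin n → Fin n → ZMod d) :
    List (Letter n d) → List (Letter n d) → Prop where
  | mu {x y : Fin n} : y < x →
      GRule n d μ [Letter.gen x, Letter.gen y]
        [Letter.J (μ x y), Letter.gen y, Letter.gen x]
  | J0 : GRule n d μ [Letter.J 0] []
  | Jadd (k k' : ZMod d) : GRule n d μ [Letter.J k, Letter.J k'] [Letter.J (k + k')]
  | xJ (x : Fin n) (k : ZMod d) :
      GRule n d μ [Letter.gen x, Letter.J k] [Letter.J k, Letter.gen x]
  | pow (x : Fin n) : GRule n d μ (List.replicate d (Letter.gen x)) []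

/-- One rewrite step: closure of the rules under contexts. -/
def GStep (n d : ℕ) (μ : Fin n → Fin n → ZMod d) (s t : List (Letter n d)) : Prop :=
  ∃ u v w₁ w₂, GRule n d μ u v ∧ s = w₁ ++ u ++ w₂ ∧ t = w₁ ++ v ++ w₂

/-- The elements of `𝒩`: `J_k x₁^{k₁} ⋯ x_n^{k_n}` with `0 ≤ kᵢ < d`
(identifying `J_0` with the empty word). -/
def NFword (n d : ℕ) (k : ZMod d) (e : Fin n → Fin d) : List (Letter n d) :=
  (if k = 0 then [] else [Letter.J k]) ++
    (List.finRange n).flatMap (fun i => List.replicate (e i : ℕ) (Letter.gen i))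

section

variable {n d : ℕ} {μ : Fin n → Fin n → ZMod d}

/-- The generators occurring in a word, in order, with the scalar letters erased. -/
def gensOf : List (Letter n d) → List (Fin n)
  | [] => []
  | Letter.gen x :: w => x :: gensOf w
  | Letter.J _ :: w => gensOf w

/-- The number of scalar letters of a word. -/
def scalarCount : List (Letter n d) → ℕ
  | [] => 0
  | Letter.gen _ :: w => scalarCount w
  | Letter.J _ :: w => scalarCount w + 1

/-- The sum over the scalar letters of a word of one plus the number of generators to their left. -/
def scalarWeight : List (Letter n d) → ℕ
  | [] => 0
  | Letter.gen _ :: w => scalarWeight w + scalarCount w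
  | Letter.J _ :: w => scalarWeight w + 1

theorem gensOf_append (s t : List (Letter n d)) : gensOf (s ++ t) = gensOf s ++ gensOf t := by
  induction s with
  | nil => rfl
  | cons a s ih => cases a <;> simp [gensOf, ih]

theorem gensOf_map_gen (g : List (Fin n)) :
    gensOf (g.map (Letter.gen : Fin n → Letter n d)) = g := by
  induction g with
  | nil => rfl
  | cons a g ih => simp [gensOf, ih]

theorem scalarCount_append (s t : List (Letter n d)) :
    scalarCount (s ++ t) = scalarCount s + scalarCount t := by
  induction s with
  | nil => simp [scalarCount]
  | cons a s ih => cases a <;> simp [scalarCount, ih]; omega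

theorem scalarWeight_append (s t : List (Letter n d)) :
    scalarWeight (s ++ t) =
      scalarWeight s + scalarWeight t + (gensOf s).length * scalarCount t := by
  induction s with
  | nil => simp [scalarWeight, gensOf]
  | cons a s ih =>
    cases a <;> simp only [List.cons_append, scalarWeight, gensOf, scalarCount_append, ih,
      List.length_cons] <;> ring

/-- A rule either decreases the generator part or keeps it and decreases the scalar part. -/
theorem GRule.decreases (hd : 2 ≤ d) {u v : List (Letter n d)} (h : GRule n d μ u v) :
    List.Shortlex (· < ·) (gensOf v) (gensOf u) ∨
      gensOf v = gensOf u ∧ scalarCount v ≤ scalarCount u ∧ scalarWeight v < scalarWeight u := by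
  cases h with
  | mu hxy =>
    exact .inl (.of_lex rfl (.rel hxy))
  | J0 => simp [gensOf, scalarCount, scalarWeight]
  | Jadd k k' => simp [gensOf, scalarCount, scalarWeight]
  | xJ x k => simp [gensOf, scalarCount, scalarWeight]
  | pow x =>
    refine .inl (.of_length_lt ?_)
    rw [← List.map_replicate, gensOf_map_gen]
    simp only [gensOf, List.length_nil, List.length_replicate]
    omega

theorem GStep.context {s t : List (Letter n d)} (h : GStep n d μ s t) (a b : List (Letter n d)) :
    GStep n d μ (a ++ s ++ b) (a ++ t ++ b) := by
  obtain ⟨u, v, w₁, w₂, hr, rfl, rfl⟩ := h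
  exact ⟨u, v, a ++ w₁, w₂ ++ b, hr, by simp, by simp⟩

theorem GRule.step {u v : List (Letter n d)} (h : GRule n d μ u v) : GStep n d μ u v :=
  ⟨u, v, [], [], h, by simp, by simp⟩

theorem GStep.decreases (hd : 2 ≤ d) {s t : List (Letter n d)} (h : GStep n d μ s t) :
    Prod.Lex (List.Shortlex (· < ·)) (· < ·) (gensOf t, scalarWeight t)
      (gensOf s, scalarWeight s) := by
  obtain ⟨u, v, w₁, w₂, hr, rfl, rfl⟩ := h
  rw [Prod.lex_def]
  simp only [gensOf_append, scalarWeight_append, List.append_assoc]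
  rcases hr.decreases hd with hlex | ⟨hg, hc, hw⟩
  · left
    refine List.Shortlex.append_left ?_ _
    rcases List.shortlex_def.mp hlex with hl | ⟨hl, hl'⟩
    · exact .of_length_lt (by simpa using hl)
    · refine .of_lex (by simp [hl]) ?_
      generalize gensOf v = a, gensOf u = b at hl hl'
      induction hl' with
      | nil => simp at hl
      | cons _ ih => exact .cons (ih (by simpa using hl))
      | rel h => exact .rel h
  · refine .inr ⟨by rw [hg], ?_⟩
    simp only [scalarCount_append, hg]
    have := Nat.mul_le_mul_left (gensOf w₁).length
      (Nat.add_le_add_right hc (scalarCount w₂))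
    omega

theorem wellFounded_gStep (hd : 2 ≤ d) :
    WellFounded (fun t s : List (Letter n d) => GStep n d μ s t) :=
  Subrelation.wf (fun h => h.decreases hd)
    (InvImage.wf (fun w => (gensOf w, scalarWeight w))
      (WellFounded.prod_lex (List.Shortlex.wf wellFounded_lt) wellFounded_lt))

/-- Left multiplication by a letter on the coordinates `(k, e)` of `J_k x₁^{e₁} ⋯ x_n^{e_n}`. -/
def Letter.act (μ : Fin n → Fin n → ZMod d) :
    Letter n d → ZMod d × (Fin n → ZMod d) → ZMod d × (Fin n → ZMod d)
  | .gen x, s => (s.1 + ∑ j ∈ Finset.Iio x, μ x j * s.2 j, s.2 + Pi.single x 1)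
  | .J k, s => (k + s.1, s.2)

theorem sum_Iio_mul_add_single {x y : Fin n} (a : Fin n → ZMod d) (m : ZMod d) (h : x ≤ y) :
    ∑ j ∈ Finset.Iio x, μ x j * (a + Pi.single y m : Fin n → ZMod d) j =
      ∑ j ∈ Finset.Iio x, μ x j * a j := by
  refine Finset.sum_congr rfl fun j hj => ?_
  have : j ≠ y := ((Finset.mem_Iio.mp hj).trans_le h).ne
  simp [this]

theorem foldr_act_replicate (x : Fin n) (m : ℕ) (s : ZMod d × (Fin n → ZMod d)) :
    (List.replicate m (Letter.gen x)).foldr (Letter.act μ) s =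
      (s.1 + m * ∑ j ∈ Finset.Iio x, μ x j * s.2 j, s.2 + Pi.single x (m : ZMod d)) := by
  induction m with
  | zero => simp
  | succ m ih =>
    rw [List.replicate_succ, List.foldr_cons, ih]
    simp only [Letter.act, sum_Iio_mul_add_single s.2 (m : ZMod d) le_rfl]
    refine Prod.ext ?_ ?_
    · push_cast; ring
    · simp [add_assoc, ← Pi.single_add]

theorem GRule.foldr_act_eq {u v : List (Letter n d)} (h : GRule n d μ u v)
    (s : ZMod d × (Fin n → ZMod d)) :
    u.foldr (Letter.act μ) s = v.foldr (Letter.act μ) s := by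
  cases h with
  | @mu x y hyx =>
    have hsum : ∑ j ∈ Finset.Iio x, μ x j * (s.2 + Pi.single y 1 : Fin n → ZMod d) j =
        ∑ j ∈ Finset.Iio x, μ x j * s.2 j + μ x y := by
      simp [mul_add, Finset.sum_add_distrib, Pi.single_apply, hyx]
    simp only [List.foldr_cons, List.foldr_nil, Letter.act, sum_Iio_mul_add_single s.2 1 hyx.le,
      hsum]
    refine Prod.ext ?_ ?_
    · ring
    · exact add_right_comm _ _ _
  | J0 => simp [Letter.act]
  | Jadd k k' => simp [Letter.act, add_assoc]
  | xJ x k => simp [Letter.act, add_assoc]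
  | pow x => simp [foldr_act_replicate]

/-- The coordinates of the normal form of a word. -/
def coords (μ : Fin n → Fin n → ZMod d) (w : List (Letter n d)) : ZMod d × (Fin n → ZMod d) :=
  w.foldr (Letter.act μ) (0, 0)

theorem GStep.coords_eq {s t : List (Letter n d)} (h : GStep n d μ s t) :
    coords μ s = coords μ t := by
  obtain ⟨u, v, w₁, w₂, hr, rfl, rfl⟩ := h
  simp only [coords, List.foldr_append, hr.foldr_act_eq]

theorem coords_eq_of_reflTransGen {s t : List (Letter n d)}
    (h : Relation.ReflTransGen (GStep n d μ) s t) : coords μ s = coords μ t := by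
  induction h with
  | refl => rfl
  | tail _ h ih => exact ih.trans h.coords_eq

theorem coords_flatMap (e : Fin n → ℕ) {l : List (Fin n)} (hl : l.Pairwise (· < ·)) :
    coords μ (l.flatMap fun i => List.replicate (e i) (Letter.gen i)) =
      (0, fun i => if i ∈ l then (e i : ZMod d) else 0) := by
  induction l with
  | nil => rfl
  | cons x l ih =>
    rw [List.pairwise_cons] at hl
    have hsum : ∑ j ∈ Finset.Iio x, μ x j * (if j ∈ l then (e j : ZMod d) else 0) = 0 := by
      refine Finset.sum_eq_zero fun j hj => ?_
      rw [if_neg fun hj' => (hl.1 j hj').not_gt (Finset.mem_Iio.mp hj), mul_zero]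
    have hx : x ∉ l := fun h => (hl.1 x h).false
    have ih' := ih hl.2
    rw [coords] at ih' ⊢
    rw [List.flatMap_cons, List.foldr_append, ih', foldr_act_replicate]
    refine Prod.ext (by simp only [hsum, mul_zero, add_zero]) (funext fun i => ?_)
    by_cases hi : i = x
    · subst hi; simp [hx]
    · simp [hi]

theorem coords_NFword (k : ZMod d) (e : Fin n → Fin d) :
    coords μ (NFword n d k e) = (k, fun i => ((e i : ℕ) : ZMod d)) := by
  have h := coords_flatMap (μ := μ) (fun i => (e i : ℕ)) (List.sortedLT_finRange n).pairwise
  rw [coords] at h ⊢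
  rw [NFword, List.foldr_append, h]
  split_ifs with hk <;> simp [Letter.act, hk]

theorem NFword_eq_of_coords_eq {k k' : ZMod d} {e e' : Fin n → Fin d}
    (h : coords μ (NFword n d k e) = coords μ (NFword n d k' e')) :
    NFword n d k e = NFword n d k' e' := by
  rw [coords_NFword, coords_NFword, Prod.mk.injEq] at h
  obtain ⟨rfl, he⟩ := h
  congr 1
  funext i
  have := congrFun he i
  rw [ZMod.natCast_eq_natCast_iff', Nat.mod_eq_of_lt (e i).2, Nat.mod_eq_of_lt (e' i).2] at this
  exact Fin.ext this

theorem irreducible_of_context {a w b : List (Letter n d)}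
    (h : ¬ ∃ t, GStep n d μ (a ++ w ++ b) t) : ¬ ∃ t, GStep n d μ w t :=
  fun ⟨_, ht⟩ => h ⟨_, ht.context a b⟩

theorem eq_scalar_append_gens_of_irreducible {w : List (Letter n d)}
    (h : ¬ ∃ t, GStep n d μ w t) :
    ∃ (k : ZMod d) (g : List (Fin n)),
      w = (if k = 0 then [] else [Letter.J k]) ++ g.map Letter.gen := by
  induction w with
  | nil => exact ⟨0, [], by simp⟩
  | cons a w ih =>
    obtain ⟨k, g, rfl⟩ := ih (irreducible_of_context (a := [a]) (b := []) (by simpa using h))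
    by_cases hk : k = 0
    · cases a with
      | gen x => exact ⟨0, x :: g, by simp [hk]⟩
      | J m =>
        refine ⟨m, g, ?_⟩
        have hm : m ≠ 0 := by
          rintro rfl
          exact h ⟨_, by simpa using GRule.J0.step.context [] _⟩
        simp [hk, hm]
    · refine absurd ?_ h
      cases a with
      | gen x => exact ⟨_, by simpa [hk] using (GRule.xJ x k).step.context [] (g.map Letter.gen)⟩
      | J m => exact ⟨_, by simpa [hk] using (GRule.Jadd m k).step.context [] (g.map Letter.gen)⟩

theorem List.eq_flatMap_replicate_count {g : List (Fin n)} (hg : g.Pairwise (· ≤ ·)) :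
    g = (List.finRange n).flatMap fun i => List.replicate (g.count i) i := by
  refine List.Perm.eq_of_pairwise' hg ?_ ?_
  · rw [List.pairwise_flatMap]
    refine ⟨fun i _ => List.pairwise_replicate.mpr (.inr le_rfl),
      (List.sortedLT_finRange n).pairwise.imp fun {a b} hab x hx y hy => ?_⟩
    rw [List.eq_of_mem_replicate hx, List.eq_of_mem_replicate hy]
    exact hab.le
  · rw [List.perm_iff_count]
    intro i
    rw [List.count_flatMap, ← Fin.sum_univ_def]
    simp [List.count_replicate]

theorem exists_eq_NFword_of_irreducible {w : List (Letter n d)}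
    (h : ¬ ∃ t, GStep n d μ w t) : ∃ k e, w = NFword n d k e := by
  obtain ⟨k, g, rfl⟩ := eq_scalar_append_gens_of_irreducible h
  have hirr : ¬ ∃ t, GStep n d μ (g.map Letter.gen) t :=
    irreducible_of_context (b := []) (by simpa using h)
  have hsorted : g.Pairwise (· ≤ ·) := by
    rw [← List.isChain_iff_pairwise, List.isChain_iff_forall_rel_of_append_cons_cons]
    rintro x y l₁ l₂ rfl
    by_contra! hyx
    exact hirr ⟨_, by
      simpa using (GRule.mu hyx).step.context (l₁.map Letter.gen) (l₂.map Letter.gen)⟩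
  have hg := List.eq_flatMap_replicate_count hsorted
  have hcount : ∀ i, g.count i < d := by
    intro i
    by_contra! hi
    obtain ⟨l₁, l₂, hl⟩ := List.append_of_mem (List.mem_finRange i)
    obtain ⟨c, hc⟩ := Nat.exists_eq_add_of_le hi
    rw [hl, List.flatMap_append, List.flatMap_cons, hc, List.replicate_add] at hg
    have hpow := (GRule.pow (μ := μ) i).step.context
      ((l₁.flatMap fun j => List.replicate (g.count j) j).map Letter.gen)
      ((List.replicate c i ++ l₂.flatMap fun j => List.replicate (g.count j) j).map Letter.gen)
    rw [← List.map_replicate, ← List.map_append, ← List.map_append, List.append_assoc,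
      ← List.append_assoc (List.replicate d i), ← hg] at hpow
    exact hirr ⟨_, hpow⟩
  refine ⟨k, fun i => ⟨g.count i, hcount i⟩, ?_⟩
  conv_lhs => rw [hg]
  simp [NFword, List.map_flatMap]

theorem exists_reflTransGen_NFword (hd : 2 ≤ d) (s : List (Letter n d)) :
    ∃ k e, Relation.ReflTransGen (GStep n d μ) s (NFword n d k e) := by
  induction s using (wellFounded_gStep (μ := μ) hd).induction with
  | _ s ih =>
    by_cases h : ∃ t, GStep n d μ s t
    · obtain ⟨t, ht⟩ := h
      obtain ⟨k, e, hke⟩ := ih t ht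
      exact ⟨k, e, .head ht hke⟩
    · obtain ⟨k, e, rfl⟩ := exists_eq_NFword_of_irreducible h
      exact ⟨k, e, .refl⟩

theorem irreducible_NFword (hd : 2 ≤ d) (k : ZMod d) (e : Fin n → Fin d) :
    ¬ ∃ t, GStep n d μ (NFword n d k e) t := by
  rintro ⟨t, ht⟩
  obtain ⟨k', e', h⟩ := exists_reflTransGen_NFword (μ := μ) hd t
  rw [← NFword_eq_of_coords_eq (ht.coords_eq.trans (coords_eq_of_reflTransGen h))] at h
  have hloop := Relation.TransGen.head' ht h
  rw [← Relation.transGen_swap] at hloop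
  exact (wellFounded_gStep hd).transGen.irrefl.irrefl _ hloop

end

theorem stmt0 (n d : ℕ) (hd : 2 ≤ d) (μ : Fin n → Fin n → ZMod d)
    (hskew : ∀ x y, μ x y = - μ y x) (hdiag : ∀ x, μ x x = 0) :
    -- strong normalization
    WellFounded (fun t s : List (Letter n d) => GStep n d μ s t) ∧
    -- confluence
    (∀ s t t' : List (Letter n d), Relation.ReflTransGen (GStep n d μ) s t →
      Relation.ReflTransGen (GStep n d μ) s t' →
      ∃ u, Relation.ReflTransGen (GStep n d μ) t u ∧
        Relation.ReflTransGen (GStep n d μ) t' u) ∧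
    -- the normal forms are exactly the elements of 𝒩
    (∀ w : List (Letter n d), (¬ ∃ t, GStep n d μ w t) ↔ ∃ k e, w = NFword n d k e) ∧
    -- every word rewrites in finitely many steps to a unique word of 𝒩
    (∀ s : List (Letter n d), ∃! t, Relation.ReflTransGen (GStep n d μ) s t ∧
      ∃ k e, t = NFword n d k e) := by
  refine ⟨wellFounded_gStep hd, fun s t t' ht ht' => ?_,
    fun w => ⟨exists_eq_NFword_of_irreducible, ?_⟩, fun s => ?_⟩
  · obtain ⟨k, e, h⟩ := exists_reflTransGen_NFword (μ := μ) hd t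
    obtain ⟨k', e', h'⟩ := exists_reflTransGen_NFword (μ := μ) hd t'
    refine ⟨_, h, ?_⟩
    rwa [NFword_eq_of_coords_eq ((coords_eq_of_reflTransGen (ht.trans h)).symm.trans
      (coords_eq_of_reflTransGen (ht'.trans h')))]
  · rintro ⟨k, e, rfl⟩
    exact irreducible_NFword hd k e
  · obtain ⟨k, e, h⟩ := exists_reflTransGen_NFword (μ := μ) hd s
    refine ⟨_, ⟨h, k, e, rfl⟩, ?_⟩
    rintro _ ⟨h', k', e', rfl⟩
    exact NFword_eq_of_coords_eq
      ((coords_eq_of_reflTransGen h').symm.trans (coords_eq_of_reflTransGen h))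
end

section
/- The internal ℤ_d-action on G(μ) is faithful: for all k, k' ∈ ℤ_d, if J_k ≐ J_{k'} (i.e., the words J_k and J_{k'} represent the same element of G(μ)), then k = k'. -/
/-- The (unoriented) relations R_G. -/
inductive RelG (n d : ℕ) (μ : Fin n → Fin n → ZMod d) :
    List (Letter n d) → List (Letter n d) → Prop where
  | mu (x y : Fin n) :
      RelG n d μ [Letter.gen x, Letter.gen y]
        [Letter.J (μ x y), Letter.gen y, Letter.gen x]
  | J0 : RelG n d μ [Letter.J 0] []
  | Jadd (k k' : ZMod d) : RelG n d μ [Letter.J k, Letter.J k'] [Letter.J (k + k')]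
  | Jx (k : ZMod d) (x : Fin n) :
      RelG n d μ [Letter.J k, Letter.gen x] [Letter.gen x, Letter.J k]
  | pow (x : Fin n) : RelG n d μ (List.replicate d (Letter.gen x)) []

/-- `≐`: the smallest monoid congruence on the free monoid containing the relations R_G. -/
def GCon (n d : ℕ) (μ : Fin n → Fin n → ZMod d) : Con (FreeMonoid (Letter n d)) :=
  conGen (fun a b => RelG n d μ (FreeMonoid.toList a) (FreeMonoid.toList b))

/-- The strictly lower triangular part of the commutator matrix. -/
def lowerPart {n d : ℕ} (μ : Fin n → Fin n → ZMod d) (x y : Fin n) : ZMod d :=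
  if y < x then μ x y else 0

/-- The action of a letter on `ℤ_d × ℤ_d^n`: the scalar letters translate the first coordinate,
and the generators act by twisted translations with cocycle `lowerPart μ`. -/
def letterAct {n d : ℕ} (μ : Fin n → Fin n → ZMod d) :
    Letter n d → Function.End (ZMod d × (Fin n → ZMod d))
  | .gen x => fun p => (p.1 + lowerPart μ x ⬝ᵥ p.2, p.2 + Pi.single x 1)
  | .J k => fun p => (p.1 + k, p.2)

theorem letterAct_gen {n d : ℕ} (μ : Fin n → Fin n → ZMod d) (x : Fin n)
    (p : ZMod d × (Fin n → ZMod d)) :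
    letterAct μ (.gen x) p = (p.1 + lowerPart μ x ⬝ᵥ p.2, p.2 + Pi.single x 1) :=
  rfl

theorem letterAct_J {n d : ℕ} (μ : Fin n → Fin n → ZMod d) (k : ZMod d)
    (p : ZMod d × (Fin n → ZMod d)) :
    letterAct μ (.J k) p = (p.1 + k, p.2) :=
  rfl

theorem Function.End.mul_apply_eq {α : Type*} (f g : Function.End α) (a : α) :
    (f * g) a = f (g a) :=
  rfl

theorem Function.End.one_apply_eq {α : Type*} (a : α) : (1 : Function.End α) a = a :=
  rfl

theorem letterAct_gen_pow {n d : ℕ} (μ : Fin n → Fin n → ZMod d) (x : Fin n) (m : ℕ)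
    (p : ZMod d × (Fin n → ZMod d)) :
    (letterAct μ (.gen x) ^ m) p =
      (p.1 + m * (lowerPart μ x ⬝ᵥ p.2), p.2 + Pi.single x (m : ZMod d)) := by
  induction m with
  | zero => simp [Function.End.one_apply_eq]
  | succ m ih =>
    rw [pow_succ', Function.End.mul_apply_eq, ih]
    simp only [letterAct_gen, dotProduct_add, dotProduct_single, lowerPart, lt_irrefl, if_false,
      zero_mul, add_zero, Nat.cast_succ, add_assoc, ← Pi.single_add]
    congr 2
    ring

theorem prod_map_letterAct_eq_of_relG {n d : ℕ} {μ : Fin n → Fin n → ZMod d}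
    (hskew : ∀ x y, μ x y = - μ y x) (hdiag : ∀ x, μ x x = 0) {u v : List (Letter n d)}
    (h : RelG n d μ u v) : (u.map (letterAct μ)).prod = (v.map (letterAct μ)).prod := by
  cases h with
  | mu x y =>
    funext p
    simp only [List.map_cons, List.map_nil, List.prod_cons, List.prod_nil,
      Function.End.mul_apply_eq, Function.End.one_apply_eq, letterAct_gen, letterAct_J,
      dotProduct_add, dotProduct_single]
    refine Prod.ext ?_ (add_right_comm _ _ _)
    have key : lowerPart μ x y = lowerPart μ y x + μ x y := by
      rcases lt_trichotomy x y with h | rfl | h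
      · simp [lowerPart, h, h.not_gt, hskew x y]
      · simp [hdiag]
      · simp [lowerPart, h, h.not_gt]
    linear_combination key
  | J0 =>
    funext p
    simp [letterAct_J, Function.End.one_apply_eq]
  | Jadd k k' =>
    funext p
    simp only [List.map_cons, List.map_nil, List.prod_cons, List.prod_nil,
      Function.End.mul_apply_eq, Function.End.one_apply_eq, letterAct_J]
    exact Prod.ext (by ring) rfl
  | Jx k x =>
    funext p
    simp only [List.map_cons, List.map_nil, List.prod_cons, List.prod_nil,
      Function.End.mul_apply_eq, Function.End.one_apply_eq, letterAct_gen, letterAct_J]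
    exact Prod.ext (by ring) rfl
  | pow x =>
    funext p
    rw [List.map_replicate, List.prod_replicate, letterAct_gen_pow]
    simp [Function.End.one_apply_eq]

theorem stmt3 (n d : ℕ) (hd : 2 ≤ d) (μ : Fin n → Fin n → ZMod d)
    (hskew : ∀ x y, μ x y = - μ y x) (hdiag : ∀ x, μ x x = 0) :
    ∀ k k' : ZMod d,
      GCon n d μ (FreeMonoid.ofList [Letter.J k]) (FreeMonoid.ofList [Letter.J k']) →
      k = k' := by
  intro k k' h
  have hle : GCon n d μ ≤ Con.ker (FreeMonoid.lift (letterAct μ)) :=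
    Con.conGen_le.2 fun a b hab => by
      simpa only [Con.ker_rel, FreeMonoid.lift_apply] using
        prod_map_letterAct_eq_of_relG hskew hdiag hab
  have hk : letterAct μ (.J k) = letterAct μ (.J k') := by
    simpa [Con.ker_rel, FreeMonoid.lift_apply] using hle h
  simpa [letterAct_J] using congrArg Prod.fst (congrFun hk (0, 0))
end

section
/- The map φ : H(μ) → G(μ) defined by φ(k, (k_1, …, k_n)) := [J_k x_1^{k_1} ⋯ x_n^{k_n}] is a group isomorphism; in particular G(μ) is a group of order d^{n+1}. -/
/-- The strictly-lower-triangular pairing `μ̌(k⃗, l⃗) = k⃗ᵀ μ̌ l⃗`. -/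
def cPair (n d : ℕ) (μ : Fin n → Fin n → ZMod d) (k l : Fin n → ZMod d) : ZMod d :=
  ∑ i, ∑ j, if j < i then k i * μ i j * l j else 0

/-- The product of the group H(μ). -/
def Hmul (n d : ℕ) (μ : Fin n → Fin n → ZMod d)
    (g h : ZMod d × (Fin n → ZMod d)) : ZMod d × (Fin n → ZMod d) :=
  (g.1 + h.1 + cPair n d μ g.2 h.2, g.2 + h.2)

/-- The word `J_k x₁^{k₁} ⋯ x_n^{k_n}` associated to `(k, k⃗) ∈ H(μ)`. -/
def gword (n d : ℕ) (g : ZMod d × (Fin n → ZMod d)) : List (Letter n d) :=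
  Letter.J g.1 ::
    (List.finRange n).flatMap (fun i => List.replicate ((g.2 i).val) (Letter.gen i))

/-- φ(k, k⃗) := [J_k x₁^{k₁} ⋯ x_n^{k_n}] ∈ G(μ). -/
def phi (n d : ℕ) (μ : Fin n → Fin n → ZMod d)
    (g : ZMod d × (Fin n → ZMod d)) : (GCon n d μ).Quotient :=
  Con.mk' (GCon n d μ) (FreeMonoid.ofList (gword n d g))

lemma prod_map_gword {M : Type*} [Monoid M] {n d : ℕ} (f : Letter n d → M)
    (g : ZMod d × (Fin n → ZMod d)) : ((gword n d g).map f).prod =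
      f (.J g.1) * ((List.finRange n).map fun i => f (.gen i) ^ (g.2 i).val).prod := by
  simp [gword, List.flatMap, List.prod_flatten, List.map_flatten, Function.comp_def]

/-- The carrier of `H(μ)`, as a type synonym bearing the twisted product. -/
def HGroup (n d : ℕ) (_μ : Fin n → Fin n → ZMod d) : Type := ZMod d × (Fin n → ZMod d)

section cPair

variable {n d : ℕ} (μ : Fin n → Fin n → ZMod d)

lemma cPair_zero_left (l : Fin n → ZMod d) : cPair n d μ 0 l = 0 := by simp [cPair]

lemma cPair_zero_right (k : Fin n → ZMod d) : cPair n d μ k 0 = 0 := by simp [cPair]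

lemma cPair_add_left (k k' l : Fin n → ZMod d) :
    cPair n d μ (k + k') l = cPair n d μ k l + cPair n d μ k' l := by
  simp only [cPair, ← Finset.sum_add_distrib, Pi.add_apply]
  refine Finset.sum_congr rfl fun i _ => Finset.sum_congr rfl fun j _ => ?_
  split_ifs <;> ring

lemma cPair_add_right (k l l' : Fin n → ZMod d) :
    cPair n d μ k (l + l') = cPair n d μ k l + cPair n d μ k l' := by
  simp only [cPair, ← Finset.sum_add_distrib, Pi.add_apply]
  refine Finset.sum_congr rfl fun i _ => Finset.sum_congr rfl fun j _ => ?_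
  split_ifs <;> ring

lemma cPair_single_left (a : Fin n) (c : ZMod d) (l : Fin n → ZMod d) :
    cPair n d μ (Pi.single a c) l = ∑ j, if j < a then c * μ a j * l j else 0 := by
  rw [cPair, Finset.sum_eq_single a]
  · simp
  · intro i _ hi
    simp [Pi.single_eq_of_ne hi]
  · simp

lemma cPair_single_single (a b : Fin n) (c e : ZMod d) :
    cPair n d μ (Pi.single a c) (Pi.single b e) = if b < a then c * μ a b * e else 0 := by
  rw [cPair_single_left, Finset.sum_eq_single b]
  · simp
  · intro j _ hj
    simp [Pi.single_eq_of_ne hj]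
  · simp

lemma cPair_single_left_eq_zero (a : Fin n) (c : ZMod d) (l : Fin n → ZMod d)
    (hl : ∀ j < a, l j = 0) : cPair n d μ (Pi.single a c) l = 0 := by
  rw [cPair_single_left]
  refine Finset.sum_eq_zero fun j _ => ?_
  split_ifs with h
  · simp [hl j h]
  · rfl

end cPair

namespace HGroup

variable {n d : ℕ} {μ : Fin n → Fin n → ZMod d}

/-- The element `(k, v)` of `H(μ)`. -/
def mk (μ : Fin n → Fin n → ZMod d) (k : ZMod d) (v : Fin n → ZMod d) : HGroup n d μ := (k, v)

instance : Group (HGroup n d μ) :=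
  letI : Mul (HGroup n d μ) := ⟨Hmul n d μ⟩
  letI : One (HGroup n d μ) := ⟨mk μ 0 0⟩
  letI : Inv (HGroup n d μ) := ⟨fun g => mk μ (-g.1 + cPair n d μ g.2 g.2) (-g.2)⟩
  Group.ofLeftAxioms
    (fun a b c => by
      change Hmul n d μ (Hmul n d μ a b) c = Hmul n d μ a (Hmul n d μ b c)
      simp only [Hmul, cPair_add_left, cPair_add_right, add_assoc]
      congr 1
      ring)
    (fun a => by
      change Hmul n d μ (0, 0) a = a
      simp only [Hmul, cPair_zero_left, zero_add, add_zero]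
      rfl)
    (fun a => by
      change Hmul n d μ (-a.1 + cPair n d μ a.2 a.2, -a.2) a = (0, 0)
      have h := cPair_add_left μ (-a.2) a.2 a.2
      rw [neg_add_cancel, cPair_zero_left] at h
      simp only [Hmul, neg_add_cancel]
      congr 1
      linear_combination -h)

lemma mk_mul_mk (k l : ZMod d) (v w : Fin n → ZMod d) :
    mk μ k v * mk μ l w = mk μ (k + l + cPair n d μ v w) (v + w) := rfl

lemma one_eq : (1 : HGroup n d μ) = mk μ 0 0 := rfl

/-- The image in `H(μ)` of a letter. -/
def ofLetter (μ : Fin n → Fin n → ZMod d) : Letter n d → HGroup n d μ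
  | .gen i => mk μ 0 (Pi.single i 1)
  | .J k => mk μ k 0

lemma ofLetter_gen_pow (i : Fin n) (m : ℕ) :
    ofLetter μ (.gen i) ^ m = mk μ 0 (Pi.single i (m : ZMod d)) := by
  induction m with
  | zero => simp [one_eq]
  | succ m ih =>
    rw [pow_succ, ih, ofLetter, mk_mul_mk, cPair_single_single, ← Pi.single_add]
    simp

/-- The canonical morphism from the free monoid to `H(μ)`. -/
def ofFree (μ : Fin n → Fin n → ZMod d) : FreeMonoid (Letter n d) →* HGroup n d μ :=
  FreeMonoid.lift (ofLetter μ)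

lemma ofFree_apply (w : FreeMonoid (Letter n d)) :
    ofFree μ w = (w.toList.map (ofLetter μ)).prod := FreeMonoid.lift_apply _ _

lemma GCon_le_ker (hskew : ∀ x y, μ x y = - μ y x) (hdiag : ∀ x, μ x x = 0) :
    GCon n d μ ≤ Con.ker (ofFree μ) := by
  refine Con.conGen_le.2 fun a b h => ?_
  change ofFree μ a = ofFree μ b
  rw [ofFree_apply, ofFree_apply]
  generalize a.toList = s at h
  generalize b.toList = t at h
  cases h with
  | mu x y =>
    simp only [List.map_cons, List.map_nil, List.prod_cons, List.prod_nil, mul_one, ofLetter,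
      mk_mul_mk, cPair_single_single, cPair_zero_left]
    rw [zero_add, zero_add (Pi.single y 1 + _), add_comm (Pi.single x 1)]
    congr 1
    rcases lt_trichotomy x y with h | rfl | h
    · simp [h, h.not_gt, hskew x y]
    · simp [hdiag]
    · simp [h, h.not_gt]
  | J0 => simp [ofLetter, one_eq]
  | Jadd k k' => simp [ofLetter, mk_mul_mk, cPair_zero_left]
  | Jx k x => simp [ofLetter, mk_mul_mk, cPair_zero_left, cPair_zero_right]
  | pow x => simp [ofLetter_gen_pow, one_eq]

/-- The morphism `G(μ) → H(μ)`, inverse to `phi`. -/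
def ofQuotient (hskew : ∀ x y, μ x y = - μ y x) (hdiag : ∀ x, μ x x = 0) :
    (GCon n d μ).Quotient →* HGroup n d μ :=
  Con.lift _ (ofFree μ) (GCon_le_ker hskew hdiag)

lemma prod_ofLetter_gen_pow [NeZero d] (v : Fin n → ZMod d) (l : List (Fin n))
    (hl : l.Pairwise (· < ·)) :
    (l.map fun i => ofLetter μ (.gen i) ^ (v i).val).prod =
      mk μ 0 (fun j => if j ∈ l then v j else 0) := by
  induction l with
  | nil => simp [one_eq]; rfl
  | cons a l ih =>
    rw [List.pairwise_cons] at hl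
    rw [List.map_cons, List.prod_cons, ih hl.2, ofLetter_gen_pow, ZMod.natCast_zmod_val,
      mk_mul_mk, cPair_single_left_eq_zero, add_zero, add_zero]
    · congr 1
      funext j
      by_cases hj : j = a
      · subst hj
        have : j ∉ l := fun h => lt_irrefl _ (hl.1 j h)
        simp [this]
      · simp [hj]
    · intro j hj
      exact if_neg fun h => lt_asymm hj (hl.1 j h)

lemma ofQuotient_phi [NeZero d] (hskew : ∀ x y, μ x y = - μ y x) (hdiag : ∀ x, μ x x = 0)
    (g : ZMod d × (Fin n → ZMod d)) : ofQuotient hskew hdiag (phi n d μ g) = g := by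
  have h : ofQuotient hskew hdiag (phi n d μ g) = ofFree μ (FreeMonoid.ofList (gword n d g)) := rfl
  have h' : ((List.finRange n).map fun i => ofLetter μ (.gen i) ^ (g.2 i).val).prod =
      mk μ 0 g.2 := by
    simpa using prod_ofLetter_gen_pow g.2 _ (List.pairwise_lt_finRange n)
  rw [h, ofFree_apply, FreeMonoid.toList_ofList, prod_map_gword, h', ofLetter, mk_mul_mk, cPair_zero_left, add_zero, add_zero, zero_add]
  rfl

end HGroup

namespace GCon

variable {n d : ℕ} (μ : Fin n → Fin n → ZMod d)

/-- The class of a letter in `G(μ)`. -/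
def letter (a : Letter n d) : (GCon n d μ).Quotient := Con.mk' (GCon n d μ) (FreeMonoid.of a)

lemma mk'_ofList (l : List (Letter n d)) :
    Con.mk' (GCon n d μ) (FreeMonoid.ofList l) = (l.map (letter μ)).prod := by
  induction l with
  | nil => exact map_one _
  | cons a l ih => rw [FreeMonoid.ofList_cons, map_mul, ih]; simp [letter]

lemma prod_letter_eq {s t : List (Letter n d)} (h : RelG n d μ s t) :
    (s.map (letter μ)).prod = (t.map (letter μ)).prod := by
  rw [← mk'_ofList, ← mk'_ofList]
  exact (Con.eq _).2 (ConGen.Rel.of _ _ h)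

lemma letter_J_zero : letter μ (.J 0) = 1 := by
  simpa using prod_letter_eq μ .J0

lemma letter_J_mul (k k' : ZMod d) :
    letter μ (.J k) * letter μ (.J k') = letter μ (.J (k + k')) := by
  simpa using prod_letter_eq μ (.Jadd k k')

lemma commute_J_gen (k : ZMod d) (x : Fin n) :
    Commute (letter μ (.J k)) (letter μ (.gen x)) := by
  simpa [commute_iff_eq] using prod_letter_eq μ (.Jx k x)

lemma letter_gen_mul (x y : Fin n) : letter μ (.gen x) * letter μ (.gen y) =
    letter μ (.J (μ x y)) * (letter μ (.gen y) * letter μ (.gen x)) := by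
  simpa using prod_letter_eq μ (.mu x y)

lemma letter_gen_pow (x : Fin n) : letter μ (.gen x) ^ d = 1 := by
  simpa using prod_letter_eq μ (.pow x)

lemma exists_gen_mul_gen_pow (x y : Fin n) (m : ℕ) :
    ∃ c, letter μ (.gen x) * letter μ (.gen y) ^ m =
      letter μ (.J c) * (letter μ (.gen y) ^ m * letter μ (.gen x)) := by
  induction m with
  | zero => exact ⟨0, by simp [letter_J_zero]⟩
  | succ m ih =>
    obtain ⟨c, hc⟩ := ih
    refine ⟨c + μ x y, ?_⟩
    rw [pow_succ, ← mul_assoc, hc, mul_assoc, mul_assoc, letter_gen_mul, ← letter_J_mul,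
      ← mul_assoc (_ ^ m), ← ((commute_J_gen μ (μ x y) y).pow_right m).eq]
    simp only [mul_assoc]

lemma exists_gen_mul_prod (hd : 2 ≤ d) (i : Fin n) (v : Fin n → ZMod d) (l : List (Fin n))
    (hl : l.Nodup) (hi : i ∈ l) :
    ∃ c, letter μ (.gen i) * (l.map fun j => letter μ (.gen j) ^ (v j).val).prod =
      letter μ (.J c) *
        (l.map fun j => letter μ (.gen j) ^ ((v + Pi.single i 1 : Fin n → ZMod d) j).val).prod := by
  induction l with
  | nil => simp at hi
  | cons a l ih =>
    rw [List.nodup_cons] at hl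
    simp only [List.map_cons, List.prod_cons]
    by_cases ha : a = i
    · subst ha
      refine ⟨0, ?_⟩
      have : Fact (1 < d) := ⟨hd⟩
      have : NeZero d := ⟨by omega⟩
      have htail : (l.map fun j => letter μ (.gen j) ^
          ((v + Pi.single a 1 : Fin n → ZMod d) j).val) =
          l.map fun j => letter μ (.gen j) ^ (v j).val := by
        refine List.map_congr_left fun j hj => ?_
        have : j ≠ a := fun h => hl.1 (h ▸ hj)
        simp [this]
      rw [htail, letter_J_zero, one_mul, ← mul_assoc, ← pow_succ', Pi.add_apply, Pi.single_eq_same,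
        ZMod.val_add, ZMod.val_one, ← pow_eq_pow_mod _ (letter_gen_pow μ a)]
    · obtain ⟨c, hc⟩ := ih hl.2 ((List.mem_cons.1 hi).resolve_left (Ne.symm ha))
      obtain ⟨e, he⟩ := exists_gen_mul_gen_pow μ i a (v a).val
      refine ⟨e + c, ?_⟩
      rw [← mul_assoc, he, mul_assoc, mul_assoc, hc, ← letter_J_mul, ← mul_assoc (_ ^ _),
        ← ((commute_J_gen μ c a).pow_right _).eq, Pi.add_apply, Pi.single_eq_of_ne ha, add_zero]
      simp only [mul_assoc]

lemma phi_eq (g : ZMod d × (Fin n → ZMod d)) : phi n d μ g = letter μ (.J g.1) *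
    ((List.finRange n).map fun i => letter μ (.gen i) ^ (g.2 i).val).prod := by
  rw [phi, mk'_ofList, prod_map_gword]

lemma exists_letter_mul_phi (hd : 2 ≤ d) (a : Letter n d) (g : ZMod d × (Fin n → ZMod d)) :
    ∃ g', letter μ a * phi n d μ g = phi n d μ g' := by
  cases a with
  | J k => exact ⟨(k + g.1, g.2), by rw [phi_eq, phi_eq, ← mul_assoc, letter_J_mul]⟩
  | gen i =>
    obtain ⟨c, hc⟩ := exists_gen_mul_prod μ hd i g.2 _ (List.nodup_finRange n) (List.mem_finRange i)
    refine ⟨(g.1 + c, g.2 + Pi.single i 1), ?_⟩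
    rw [phi_eq, phi_eq, ← mul_assoc, ← (commute_J_gen μ g.1 i).eq, mul_assoc, hc, ← mul_assoc,
      letter_J_mul]

lemma phi_surjective (hd : 2 ≤ d) : Function.Surjective (phi n d μ) := by
  intro q
  obtain ⟨w, rfl⟩ := Con.mk'_surjective q
  rw [← FreeMonoid.ofList_toList w, mk'_ofList]
  induction w.toList with
  | nil => exact ⟨(0, 0), by simp [phi_eq, letter_J_zero]⟩
  | cons a l ih =>
    obtain ⟨g, hg⟩ := ih
    obtain ⟨g', hg'⟩ := exists_letter_mul_phi μ hd a g
    exact ⟨g', by rw [List.map_cons, List.prod_cons, ← hg, hg']⟩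

end GCon

theorem stmt4 (n d : ℕ) (hn : 1 ≤ n) (hd : 2 ≤ d) (μ : Fin n → Fin n → ZMod d)
    (hskew : ∀ x y, μ x y = - μ y x) (hdiag : ∀ x, μ x x = 0) :
    -- φ is a bijective homomorphism from H(μ) to G(μ)
    Function.Bijective (phi n d μ) ∧
    (∀ g h : ZMod d × (Fin n → ZMod d),
      phi n d μ (Hmul n d μ g h) = phi n d μ g * phi n d μ h) ∧
    -- in particular the monoid G(μ) is a group ...
    (∀ a : (GCon n d μ).Quotient, ∃ b, a * b = 1 ∧ b * a = 1) ∧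
    -- ... of order d^(n+1)
    Nat.card (GCon n d μ).Quotient = d ^ (n + 1) := by
  have : NeZero d := ⟨by omega⟩
  have hleft := HGroup.ofQuotient_phi hskew hdiag
  have hsurj := GCon.phi_surjective μ hd
  have hbij : Function.Bijective (phi n d μ) := ⟨Function.LeftInverse.injective hleft, hsurj⟩
  have hinj : Function.Injective (HGroup.ofQuotient hskew hdiag) :=
    (Function.LeftInverse.rightInverse_of_surjective hleft hsurj).injective
  refine ⟨hbij, fun g h => hinj ?_, fun a => ?_, ?_⟩
  · rw [map_mul, hleft, hleft, hleft]
    rfl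
  · obtain ⟨b, hb⟩ : ∃ b, HGroup.ofQuotient hskew hdiag b =
        (HGroup.ofQuotient hskew hdiag a)⁻¹ := ⟨_, hleft _⟩
    exact ⟨b, hinj (by rw [map_mul, hb, mul_inv_cancel, map_one]),
      hinj (by rw [map_mul, hb, inv_mul_cancel, map_one])⟩
  · rw [← Nat.card_congr (Equiv.ofBijective _ hbij)]
    simp [pow_succ']
end

section
/- Let β be any bracketing with ∂(β) = s, and let Φ(β) be the multiset of pairs (∂(β₁), ∂(β₂)) over internal nodes of β with children β₁, β₂. Then Σ_{(u,v) ∈ Φ(β)} ⟦u,v⟧ = Σ𝒮(s) − Σ𝒮(s†), where s† is the reverse of s. -/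
/-- `Σ𝒮(s)`: the sum over inversions of the word `s`. -/
def invSum (n d : ℕ) (μ : Fin n → Fin n → ZMod d) : List (Fin n) → ZMod d
  | [] => 0
  | x :: s => (s.map (fun y => if y < x then μ x y else 0)).sum + invSum n d μ s

/-- `Σ𝒮(s,t)`: the sum over inversions between `s` and `t`. -/
def invSum2 (n d : ℕ) (μ : Fin n → Fin n → ZMod d) (s t : List (Fin n)) : ZMod d :=
  (s.map (fun x => (t.map (fun y => if y < x then μ x y else 0)).sum)).sum

/-- The formal commutator `⟦s,t⟧ := Σ𝒮(s,t) − Σ𝒮(t,s)`. -/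
def fcomm (n d : ℕ) (μ : Fin n → Fin n → ZMod d) (s t : List (Fin n)) : ZMod d :=
  invSum2 n d μ s t - invSum2 n d μ t s

/-- Bracketings: binary trees with leaves labelled by generators. -/
inductive Brack (n : ℕ) : Type where
  | leaf : Fin n → Brack n
  | node : Brack n → Brack n → Brack n

/-- `∂(β)`: the word of leaf labels of a bracketing. -/
def Brack.word {n : ℕ} : Brack n → List (Fin n)
  | .leaf x => [x]
  | .node b₁ b₂ => b₁.word ++ b₂.word

/-- The sum of the formal commutators `⟦∂(β₁), ∂(β₂)⟧` over all internal nodes of β,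
i.e. the sum of `⟦u,v⟧` over the multiset Φ(β). -/
def Brack.commSum (n d : ℕ) (μ : Fin n → Fin n → ZMod d) : Brack n → ZMod d
  | .leaf _ => 0
  | .node b₁ b₂ =>
      fcomm n d μ b₁.word b₂.word + Brack.commSum n d μ b₁ + Brack.commSum n d μ b₂

theorem invSum_append (n d : ℕ) (μ : Fin n → Fin n → ZMod d) (s t : List (Fin n)) :
    invSum n d μ (s ++ t) = invSum n d μ s + invSum n d μ t + invSum2 n d μ s t := by
  induction s with
  | nil => simp [invSum, invSum2]
  | cons x s ih =>
    simp only [invSum, invSum2, List.cons_append, List.map_append, List.sum_append,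
      List.map_cons, List.sum_cons] at ih ⊢
    rw [ih]
    ring

theorem invSum2_reverse (n d : ℕ) (μ : Fin n → Fin n → ZMod d) (s t : List (Fin n)) :
    invSum2 n d μ s.reverse t.reverse = invSum2 n d μ s t := by
  simp only [invSum2, List.map_reverse, List.sum_reverse]

theorem stmt9 (n d : ℕ) (hd : 2 ≤ d) (μ : Fin n → Fin n → ZMod d)
    (hskew : ∀ x y, μ x y = - μ y x) (hdiag : ∀ x, μ x x = 0) :
    ∀ β : Brack n,
      Brack.commSum n d μ β = invSum n d μ β.word - invSum n d μ β.word.reverse := by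
  intro β
  induction β with
  | leaf x => simp [Brack.commSum, Brack.word]
  | node b₁ b₂ ih₁ ih₂ =>
    simp only [Brack.commSum, Brack.word, fcomm, List.reverse_append, invSum_append,
      invSum2_reverse, ih₁, ih₂]
    ring
end

section
/- Let w be a word over 𝒳 in which each generator x occurs n_x times. Then Σ𝒮(w) + Σ𝒮(w†) = Σ_{x < y} n_y · n_x · μ(y,x) in ℤ_d (with the multiplicities n_x reduced modulo d). In particular, if d divides n_x for every x ∈ 𝒳, then Σ𝒮(w) = −Σ𝒮(w†). -/
theorem sum_map_eq_sum_count_mul {ι R : Type*} [Fintype ι] [DecidableEq ι] [CommSemiring R]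
    (f : ι → R) (s : List ι) : (s.map f).sum = ∑ y, (s.count y : R) * f y := by
  induction s with
  | nil => simp
  | cons x s ih =>
    simp [List.count_cons, ih, add_mul, Finset.sum_add_distrib, add_comm]

theorem invSum_append_singleton (n d : ℕ) (μ : Fin n → Fin n → ZMod d) (s : List (Fin n))
    (x : Fin n) :
    invSum n d μ (s ++ [x]) =
      invSum n d μ s + (s.map (fun y => if x < y then μ y x else 0)).sum := by
  induction s with
  | nil => simp [invSum]
  | cons y s ih =>
    simp only [List.cons_append, invSum, ih, List.map_append, List.sum_append, List.map_cons,
      List.map_nil, List.sum_cons, List.sum_nil]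
    ring

theorem invSum_add_invSum_reverse (n d : ℕ) (μ : Fin n → Fin n → ZMod d) (w : List (Fin n)) :
    invSum n d μ w + invSum n d μ w.reverse =
      ∑ y : Fin n, ∑ x : Fin n, (w.count y : ZMod d) * (w.count x : ZMod d) *
        (if x < y then μ y x else 0) := by
  induction w with
  | nil => simp [invSum]
  | cons z s ih =>
    rw [List.reverse_cons, invSum_append_singleton, invSum, sum_map_eq_sum_count_mul,
      sum_map_eq_sum_count_mul]
    simp only [List.count_reverse]
    have expand : ∀ y x : Fin n, ((z :: s).count y : ZMod d) * ((z :: s).count x : ZMod d) *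
        (if x < y then μ y x else 0) =
        (s.count y : ZMod d) * (s.count x : ZMod d) * (if x < y then μ y x else 0) +
        (if z = y then (s.count x : ZMod d) * (if x < z then μ z x else 0) else 0) +
        (if z = x then (s.count y : ZMod d) * (if z < y then μ y z else 0) else 0) := by
      intro y x
      by_cases hy : z = y <;> by_cases hx : z = x
      · subst hy; subst hx; simp
      · subst hy; simp [hx]; split_ifs <;> ring
      · subst hx; simp [hy]; split_ifs <;> ring
      · simp [hx, hy]
    simp only [expand, Finset.sum_add_distrib, ← ih]
    rw [Finset.sum_comm (f := fun y x => if z = y then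
      (s.count x : ZMod d) * (if x < z then μ z x else 0) else 0)]
    simp only [Finset.sum_ite_eq, Finset.mem_univ, if_true]
    ring

theorem stmt10 (n d : ℕ) (hd : 2 ≤ d) (μ : Fin n → Fin n → ZMod d)
    (hskew : ∀ x y, μ x y = - μ y x) (hdiag : ∀ x, μ x x = 0) :
    ∀ w : List (Fin n),
      (invSum n d μ w + invSum n d μ w.reverse =
        ∑ y : Fin n, ∑ x : Fin n, if x < y then
          ((w.count y : ZMod d) * (w.count x : ZMod d)) * μ y x else 0) ∧
      ((∀ x : Fin n, d ∣ w.count x) →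
        invSum n d μ w = - invSum n d μ w.reverse) := by
  intro w
  have h := invSum_add_invSum_reverse n d μ w
  refine ⟨by simpa only [mul_ite, mul_zero] using h, fun hw => ?_⟩
  have hc : ∀ x, (w.count x : ZMod d) = 0 := fun x => (ZMod.natCast_eq_zero_iff _ _).2 (hw x)
  exact eq_neg_of_add_eq_zero_left (by simpa [hc] using h)
end

section
/- If there exists a contextual word for μ over ℤ_d, then d is even. -/
/-- A bracketing witnesses commuting products if `⟦∂(β₁), ∂(β₂)⟧ = 0` at every internal node. -/
def Brack.Ok (n d : ℕ) (μ : Fin n → Fin n → ZMod d) : Brack n → Prop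
  | .leaf _ => True
  | .node b₁ b₂ =>
      fcomm n d μ b₁.word b₂.word = 0 ∧ Brack.Ok n d μ b₁ ∧ Brack.Ok n d μ b₂

/-- `w` is formed out of commuting products. -/
def Commuting (n d : ℕ) (μ : Fin n → Fin n → ZMod d) (w : List (Fin n)) : Prop :=
  ∃ β : Brack n, Brack.Ok n d μ β ∧ β.word = w

/-- A contextual word for μ. -/
def ContextualWord (n d : ℕ) (μ : Fin n → Fin n → ZMod d) (w : List (Fin n)) : Prop :=
  w ≠ [] ∧ (∀ x : Fin n, d ∣ w.count x) ∧ Commuting n d μ w ∧ invSum n d μ w ≠ 0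

theorem List.sum_map_eq_sum_count_mul {n d : ℕ} (s : List (Fin n)) (g : Fin n → ZMod d) :
    (s.map g).sum = ∑ x, (s.count x : ZMod d) * g x := by
  induction s with
  | nil => simp
  | cons a s ih => simp [ih, List.count_cons, add_mul, Finset.sum_add_distrib, add_comm]

/-- The sum of `μ (s i) (s j)` over all pairs of positions `i < j` of the word `s`. -/
def pairSum {n d : ℕ} (μ : Fin n → Fin n → ZMod d) : List (Fin n) → ZMod d
  | [] => 0
  | x :: s => (s.map (μ x)).sum + pairSum μ s

theorem pairSum_append {n d : ℕ} (μ : Fin n → Fin n → ZMod d) (s t : List (Fin n)) :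
    pairSum μ (s ++ t) =
      pairSum μ s + pairSum μ t + (s.map fun x => (t.map (μ x)).sum).sum := by
  induction s with
  | nil => simp [pairSum]
  | cons a s ih => simp only [List.cons_append, pairSum, ih, List.map_append, List.sum_append,
      List.map_cons, List.sum_cons]; ring

/-- The formal commutator is the bilinear form determined by a commutator matrix. -/
theorem fcomm_eq_sum {n d : ℕ} {μ : Fin n → Fin n → ZMod d}
    (hskew : ∀ x y, μ x y = - μ y x) (hdiag : ∀ x, μ x x = 0) (s t : List (Fin n)) :
    fcomm n d μ s t = (s.map fun x => (t.map (μ x)).sum).sum := by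
  simp only [fcomm, invSum2, List.sum_map_eq_sum_count_mul, Finset.mul_sum]
  rw [Finset.sum_comm (s := Finset.univ) (t := Finset.univ)
    (f := fun x y => (t.count x : ZMod d) * ((s.count y : ZMod d) * if y < x then μ x y else 0)),
    ← Finset.sum_sub_distrib]
  refine Finset.sum_congr rfl fun x _ => ?_
  rw [← Finset.sum_sub_distrib]
  refine Finset.sum_congr rfl fun y _ => ?_
  rcases lt_trichotomy x y with h | rfl | h
  · simp only [h, h.not_gt, if_true, if_false, hskew y x]; ring
  · simp [hdiag]
  · simp [h, h.not_gt]

theorem Brack.Ok.pairSum_word_eq_zero {n d : ℕ} {μ : Fin n → Fin n → ZMod d}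
    (hskew : ∀ x y, μ x y = - μ y x) (hdiag : ∀ x, μ x x = 0) {β : Brack n}
    (h : Brack.Ok n d μ β) : pairSum μ β.word = 0 := by
  induction β with
  | leaf x => simp [Brack.word, pairSum]
  | node b₁ b₂ ih₁ ih₂ =>
    obtain ⟨h₀, h₁, h₂⟩ := h
    rw [Brack.word, pairSum_append, ih₁ h₁, ih₂ h₂, ← fcomm_eq_sum hskew hdiag, h₀]
    simp

/-- Twice the inversion sum exceeds the sum over all ordered pairs of positions by a quantity that
depends only on the letter counts. -/
theorem two_mul_invSum {n d : ℕ} {μ : Fin n → Fin n → ZMod d}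
    (hskew : ∀ x y, μ x y = - μ y x) (hdiag : ∀ x, μ x x = 0) (s : List (Fin n)) :
    2 * invSum n d μ s = pairSum μ s +
      ∑ x, ∑ y, (s.count x : ZMod d) * ((s.count y : ZMod d) * if y < x then μ x y else 0) := by
  induction s with
  | nil => simp [invSum, pairSum]
  | cons a s ih =>
    have key : 2 * ∑ y, (s.count y : ZMod d) * (if y < a then μ a y else 0) =
        ∑ y, (s.count y : ZMod d) * μ a y +
          (∑ y, (s.count y : ZMod d) * (if y < a then μ a y else 0) +
            ∑ y, (s.count y : ZMod d) * (if a < y then μ y a else 0)) := by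
      rw [Finset.mul_sum, ← Finset.sum_add_distrib, ← Finset.sum_add_distrib]
      refine Finset.sum_congr rfl fun y _ => ?_
      rcases lt_trichotomy y a with h | rfl | h
      · simp only [h, h.not_gt, if_true, if_false]; ring
      · simp [hdiag]
      · simp only [h, h.not_gt, if_true, if_false, hskew y a]; ring
    have expand : ∑ x, ∑ y, ((a :: s).count x : ZMod d) *
          (((a :: s).count y : ZMod d) * if y < x then μ x y else 0) =
        ∑ x, ∑ y, (s.count x : ZMod d) * ((s.count y : ZMod d) * if y < x then μ x y else 0) +
          (∑ y, (s.count y : ZMod d) * (if y < a then μ a y else 0) +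
            ∑ y, (s.count y : ZMod d) * (if a < y then μ y a else 0)) := by
      simp only [← Finset.mul_sum, ← List.sum_map_eq_sum_count_mul, List.map_cons, List.sum_cons,
        lt_irrefl, if_false, List.sum_map_add]
      ring
    rw [invSum, pairSum, mul_add, ih, expand]
    simp only [List.sum_map_eq_sum_count_mul] at key ⊢
    rw [key]
    ring

theorem stmt11 (n d : ℕ) (hd : 2 ≤ d) (μ : Fin n → Fin n → ZMod d)
    (hskew : ∀ x y, μ x y = - μ y x) (hdiag : ∀ x, μ x x = 0) :
    (∃ w : List (Fin n), ContextualWord n d μ w) → Even d := by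
  rintro ⟨w, -, hcount, ⟨β, hβ, rfl⟩, hne⟩
  by_contra hodd
  have h2 : IsUnit ((2 : ℕ) : ZMod d) :=
    (ZMod.isUnit_iff_coprime 2 d).2 (Nat.coprime_two_left.2 (Nat.not_even_iff_odd.1 hodd))
  refine hne (h2.mul_right_eq_zero.1 ?_)
  have hzero (x : Fin n) : (β.word.count x : ZMod d) = 0 :=
    (ZMod.natCast_eq_zero_iff _ _).2 (hcount x)
  rw [Nat.cast_ofNat, two_mul_invSum hskew hdiag, hβ.pairSum_word_eq_zero hskew hdiag]
  simp [hzero]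
end

section
/- Suppose the restriction of the compatibility relation ⊙ to C(μ) ∖ 𝒵(C(μ)) is a cluster graph, i.e., ⊙ is transitive on C(μ) ∖ 𝒵(C(μ)). Then every empirical model over C(μ) is non-contextual: it admits a global section s : C(μ) → ℤ_d with s|_C ∈ e_C for every maximal clique C. -/
/-- C(μ): the smallest subset of H(μ) containing the scalars `(k, 0⃗)` and the
generators `(0, eᵢ)`, closed under products of commuting elements. -/
inductive InC (n d : ℕ) (μ : Fin n → Fin n → ZMod d) : ZMod d × (Fin n → ZMod d) → Prop where
  | scalar (k : ZMod d) : InC n d μ (k, 0)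
  | gen (i : Fin n) : InC n d μ (0, Pi.single i 1)
  | mul {g h : ZMod d × (Fin n → ZMod d)} : InC n d μ g → InC n d μ h →
      Hmul n d μ g h = Hmul n d μ h g → InC n d μ (Hmul n d μ g h)

/-- The compatibility (commeasurability) relation ⊙. -/
def Odot (n d : ℕ) (μ : Fin n → Fin n → ZMod d) (g h : ZMod d × (Fin n → ZMod d)) : Prop :=
  Hmul n d μ g h = Hmul n d μ h g

/-- Membership in 𝒵(C(μ)): elements of C(μ) compatible with everything in C(μ). -/
def IsZed (n d : ℕ) (μ : Fin n → Fin n → ZMod d) (a : ZMod d × (Fin n → ZMod d)) : Prop :=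
  InC n d μ a ∧ ∀ b, InC n d μ b → Odot n d μ a b

/-- Maximal cliques of the graph (C(μ), ⊙). -/
def IsMaxClique (n d : ℕ) (μ : Fin n → Fin n → ZMod d)
    (C : Set (ZMod d × (Fin n → ZMod d))) : Prop :=
  (∀ g ∈ C, InC n d μ g) ∧ (∀ g ∈ C, ∀ h ∈ C, Odot n d μ g h) ∧
    ∀ C' : Set (ZMod d × (Fin n → ZMod d)), (∀ g ∈ C', InC n d μ g) →
      (∀ g ∈ C', ∀ h ∈ C', Odot n d μ g h) → C ⊆ C' → C' = C

/-- A section on a maximal clique C: a homomorphism C → ℤ_d splitting the scalars. -/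
def IsSectionOn (n d : ℕ) (μ : Fin n → Fin n → ZMod d)
    (C : Set (ZMod d × (Fin n → ZMod d))) (s : ZMod d × (Fin n → ZMod d) → ZMod d) : Prop :=
  (∀ k : ZMod d, ((k, 0) : ZMod d × (Fin n → ZMod d)) ∈ C → s (k, 0) = k) ∧
  ∀ g ∈ C, ∀ h ∈ C, s (Hmul n d μ g h) = s g + s h

/-- A (possibilistic) empirical model over C(μ): for each maximal clique, a nonempty
set of sections, satisfying local consistency on overlaps. -/
def IsEmpiricalModel (n d : ℕ) (μ : Fin n → Fin n → ZMod d)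
    (e : Set (ZMod d × (Fin n → ZMod d)) → Set (ZMod d × (Fin n → ZMod d) → ZMod d)) : Prop :=
  (∀ C, IsMaxClique n d μ C → (e C).Nonempty ∧ ∀ s ∈ e C, IsSectionOn n d μ C s) ∧
  ∀ C C', IsMaxClique n d μ C → IsMaxClique n d μ C' →
    ∀ s ∈ e C, ∃ s' ∈ e C', ∀ g ∈ C ∩ C', s g = s' g

/-- Central elements of C(μ) lie in every maximal clique. -/
theorem IsMaxClique.mem_of_isZed {n d : ℕ} {μ : Fin n → Fin n → ZMod d}
    {C : Set (ZMod d × (Fin n → ZMod d))} (hC : IsMaxClique n d μ C)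
    {a : ZMod d × (Fin n → ZMod d)} (ha : IsZed n d μ a) : a ∈ C := by
  have h : insert a C = C := by
    refine hC.2.2 _ ?_ ?_ (Set.subset_insert a C)
    · rintro g (rfl | hg)
      exacts [ha.1, hC.1 g hg]
    · rintro g (rfl | hg) h (rfl | hh)
      exacts [rfl, ha.2 h (hC.1 h hh), (ha.2 g (hC.1 g hg)).symm, hC.2.1 g hg h hh]
  exact h ▸ Set.mem_insert a C

/-- If ⊙ is transitive off the center, two maximal cliques sharing a non-central element agree. -/
theorem IsMaxClique.eq_of_mem_of_not_isZed {n d : ℕ} {μ : Fin n → Fin n → ZMod d}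
    (hcluster : ∀ a b c : ZMod d × (Fin n → ZMod d),
      InC n d μ a → InC n d μ b → InC n d μ c →
      ¬ IsZed n d μ a → ¬ IsZed n d μ b → ¬ IsZed n d μ c →
      Odot n d μ a b → Odot n d μ b c → Odot n d μ a c)
    {C C' : Set (ZMod d × (Fin n → ZMod d))} (hC : IsMaxClique n d μ C)
    (hC' : IsMaxClique n d μ C') {g : ZMod d × (Fin n → ZMod d)} (hg : g ∈ C) (hg' : g ∈ C')
    (hz : ¬ IsZed n d μ g) : C = C' := by
  have cross : ∀ a ∈ C, ∀ b ∈ C', Odot n d μ a b := by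
    intro a ha b hb
    by_cases hza : IsZed n d μ a
    · exact hza.2 b (hC'.1 b hb)
    by_cases hzb : IsZed n d μ b
    · exact (hzb.2 a (hC.1 a ha)).symm
    exact hcluster a g b (hC.1 a ha) (hC.1 g hg) (hC'.1 b hb) hza hz hzb
      (hC.2.1 a ha g hg) (hC'.2.1 g hg' b hb)
  have mem : ∀ a ∈ C ∪ C', InC n d μ a := fun a ha => ha.elim (hC.1 a) (hC'.1 a)
  have clique : ∀ a ∈ C ∪ C', ∀ b ∈ C ∪ C', Odot n d μ a b := by
    rintro a (ha | ha) b (hb | hb)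
    exacts [hC.2.1 a ha b hb, cross a ha b hb, (cross b hb a ha).symm, hC'.2.1 a ha b hb]
  exact (hC.2.2 _ mem clique Set.subset_union_left).symm.trans
    (hC'.2.2 _ mem clique Set.subset_union_right)

theorem stmt14 (n d : ℕ) (hn : 1 ≤ n) (hd : 2 ≤ d) (μ : Fin n → Fin n → ZMod d)
    (hskew : ∀ i j, μ i j = - μ j i) (hdiag : ∀ i, μ i i = 0)
    -- (C(μ) ∖ 𝒵(C(μ)), ⊙) is a cluster graph: ⊙ is transitive on C(μ) ∖ 𝒵(C(μ))
    (hcluster : ∀ a b c : ZMod d × (Fin n → ZMod d),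
      InC n d μ a → InC n d μ b → InC n d μ c →
      ¬ IsZed n d μ a → ¬ IsZed n d μ b → ¬ IsZed n d μ c →
      Odot n d μ a b → Odot n d μ b c → Odot n d μ a c) :
    -- every empirical model over C(μ) is non-contextual: it has a global section
    ∀ e, IsEmpiricalModel n d μ e →
      ∃ s : ZMod d × (Fin n → ZMod d) → ZMod d,
        ∀ C, IsMaxClique n d μ C → ∃ s' ∈ e C, ∀ g ∈ C, s g = s' g := by
  classical
  rintro e ⟨hne, hloc⟩
  by_cases hex : ∃ C, IsMaxClique n d μ C
  swap
  · exact ⟨0, fun C hC => absurd ⟨C, hC⟩ hex⟩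
  obtain ⟨C₀, hC₀⟩ := hex
  obtain ⟨s₀, hs₀⟩ := (hne C₀ hC₀).1
  choose! f hf hf₀ using fun C hC => hloc C₀ C hC₀ hC s₀ hs₀
  refine ⟨fun g => if h : ∃ C, IsMaxClique n d μ C ∧ g ∈ C then f h.choose g else 0,
    fun C hC => ⟨f C, hf C hC, fun g hg => ?_⟩⟩
  have h : ∃ C, IsMaxClique n d μ C ∧ g ∈ C := ⟨C, hC, hg⟩
  simp only [dif_pos h]
  obtain ⟨hC', hg'⟩ := h.choose_spec
  by_cases hz : IsZed n d μ g
  · have hg₀ := hC₀.mem_of_isZed hz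
    exact (hf₀ _ hC' g ⟨hg₀, hg'⟩).symm.trans (hf₀ C hC g ⟨hg₀, hg⟩)
  · rw [hC'.eq_of_mem_of_not_isZed hcluster hC hg' hg hz]
end

section
/- Every commutator matrix μ over ℤ_d is cogredient to a matrix in Darboux normal form: there exists an invertible n×n matrix U over ℤ_d such that (UᵀμU)(i,j) = 0 whenever {i,j} is not of the form {2t−1, 2t}, i.e., the only possibly nonzero entries of UᵀμU occur in 2×2 blocks [[0, λ_t],[−λ_t, 0]] on the main diagonal. -/
open Module

/-- Over a Euclidean domain, a nonzero value `B x y` of a bilinear form `B` of minimal Euclidean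
size divides all values `B x z` and `B z y`. -/
theorem LinearMap.BilinForm.exists_apply_ne_zero_dvd {R V : Type*} [EuclideanDomain R]
    [AddCommGroup V] [Module R V] (B : LinearMap.BilinForm R V) (hB : B ≠ 0) :
    ∃ x y, B x y ≠ 0 ∧ (∀ z, B x y ∣ B x z) ∧ ∀ z, B x y ∣ B z y := by
  have hne : {a : R | a ≠ 0 ∧ ∃ x y, B x y = a}.Nonempty := by
    by_contra! h
    refine hB (LinearMap.ext fun x => LinearMap.ext fun y => ?_)
    by_contra hxy
    exact Set.eq_empty_iff_forall_notMem.1 h _ ⟨hxy, x, y, rfl⟩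
  obtain ⟨_, ⟨hxy, x, y, rfl⟩, hmin⟩ := EuclideanDomain.r_wellFounded.has_min _ hne
  have hdvd (a : R) (ha : ∃ z w, B z w = a % B x y) : B x y ∣ a := by
    rw [← EuclideanDomain.mod_eq_zero]
    by_contra h
    exact hmin _ ⟨h, ha⟩ (EuclideanDomain.mod_lt a hxy)
  refine ⟨x, y, hxy, fun z => hdvd _ ⟨x, z - (B x z / B x y) • y, ?_⟩,
    fun z => hdvd _ ⟨z - (B z y / B x y) • x, y, ?_⟩⟩
  · rw [map_sub, map_smul, smul_eq_mul, EuclideanDomain.mod_eq_sub_mul_div, mul_comm]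
  · rw [map_sub, map_smul, LinearMap.sub_apply, LinearMap.smul_apply, smul_eq_mul,
      EuclideanDomain.mod_eq_sub_mul_div, mul_comm]

/-- An alternating bilinear form on a finite free module over a Euclidean domain admits a
basis in which its matrix is block diagonal with alternating blocks of size two. -/
theorem LinearMap.BilinForm.IsAlt.exists_darboux_basis {R V : Type*} [EuclideanDomain R]
    [AddCommGroup V] [Module R V] [Module.Free R V] [Module.Finite R V]
    {B : LinearMap.BilinForm R V} (hB : B.IsAlt) {n : ℕ} (hn : finrank R V = n) :
    ∃ b : Basis (Fin n) R V,
      ∀ i j : Fin n, ¬(i ≠ j ∧ i.val / 2 = j.val / 2) → B (b i) (b j) = 0 := by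
  induction n using Nat.strong_induction_on generalizing V with
  | _ n ih =>
  rcases eq_or_ne B 0 with rfl | h0
  · exact ⟨finBasisOfFinrankEq R V hn, fun _ _ _ => rfl⟩
  obtain ⟨x, y, hxy, hx, hy⟩ := B.exists_apply_ne_zero_dvd h0
  let O : Submodule R V := LinearMap.ker (B.flip y)
  let W : Submodule R V := LinearMap.ker (B x) ⊓ O
  have hO : ∀ {v}, v ∈ O ↔ B v y = 0 := Iff.rfl
  have hW : ∀ {v}, v ∈ W ↔ B x v = 0 ∧ B v y = 0 := Iff.rfl
  have extend (k : ℕ) (c : Basis (Fin k) R W) :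
      ∃ b : Basis (Fin (k + 2)) R V,
        (b : Fin (k + 2) → V) = Fin.cons x (Fin.cons y fun i => (c i : V)) := by
    let c' : Basis (Fin (k + 1)) R O := Basis.mkFinConsOfLE y (hO.2 (hB y)) c inf_le_right
      (fun a w hw h => by
        have := congrArg (B x) h
        simpa [(hW.1 hw).1, hxy] using this)
      (fun z hz => by
        obtain ⟨a, ha⟩ := hx z
        refine ⟨-a, hW.2 ⟨?_, ?_⟩⟩
        · rw [map_add, map_smul, ha, smul_eq_mul]; ring
        · simp [hO.1 hz, hB y])
    refine ⟨Basis.mkFinCons x c'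
      (fun a w hw h => by
        have := congrArg (fun v => B v y) h
        simpa [hO.1 hw, hxy] using this)
      (fun z => by
        obtain ⟨a, ha⟩ := hy z
        refine ⟨-a, hO.2 ?_⟩
        rw [map_add, map_smul, LinearMap.add_apply, LinearMap.smul_apply, ha, smul_eq_mul]
        ring), ?_⟩
    rw [Basis.coe_mkFinCons]
    congr 1
    rw [Basis.coe_mkFinConsOfLE]
    funext i
    refine Fin.cases ?_ (fun i => ?_) i <;> simp
  have hrank : finrank R V = finrank R W + 2 := by
    obtain ⟨b, -⟩ := extend _ (finBasis R W)
    simpa using finrank_eq_card_basis b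
  obtain rfl : n = finrank R W + 2 := hn.symm.trans hrank
  obtain ⟨c, hc⟩ := ih (finrank R W) (by omega) (B := B.restrict W) (fun w => hB w) rfl
  obtain ⟨b, hb⟩ := extend _ c
  have hxc : ∀ i, B x (c i) = 0 := fun i => (hW.1 (c i).2).1
  have hcy : ∀ i, B (c i) y = 0 := fun i => (hW.1 (c i).2).2
  have hcx : ∀ i, B (c i) x = 0 := fun i => hB.isRefl _ _ (hxc i)
  have hyc : ∀ i, B y (c i) = 0 := fun i => hB.isRefl _ _ (hcy i)
  refine ⟨b, fun i j hij => ?_⟩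
  rw [hb]
  induction i using Fin.cases with
  | zero =>
    induction j using Fin.cases with
    | zero => exact hB x
    | succ j =>
      induction j using Fin.cases with
      | zero => exact absurd ⟨by simp, by simp⟩ hij
      | succ j => simpa using hxc j
  | succ i =>
    induction i using Fin.cases with
    | zero =>
      induction j using Fin.cases with
      | zero => exact absurd ⟨by simp, by simp⟩ hij
      | succ j =>
        induction j using Fin.cases with
        | zero => exact hB y
        | succ j => simpa using hyc j
    | succ i =>
      induction j using Fin.cases with
      | zero => simpa using hcx i
      | succ j =>
        induction j using Fin.cases with
        | zero => simpa using hcy i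
        | succ j =>
          refine hc i j fun ⟨h1, h2⟩ => hij ⟨by simpa using h1, ?_⟩
          simp only [Fin.val_succ]
          omega

/-- Every alternating matrix over a Euclidean domain is congruent to a block diagonal
matrix with alternating blocks of size two. -/
theorem Matrix.exists_isUnit_darboux {n : ℕ} {R : Type*} [EuclideanDomain R]
    (M : Matrix (Fin n) (Fin n) R) (hM : (Matrix.toBilin' M).IsAlt) :
    ∃ U : Matrix (Fin n) (Fin n) R, IsUnit U ∧
      ∀ i j : Fin n, ¬(i ≠ j ∧ i.val / 2 = j.val / 2) → (U.transpose * M * U) i j = 0 := by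
  obtain ⟨b, hb⟩ := hM.exists_darboux_basis (finrank_fin_fun R)
  let := (Pi.basisFun R (Fin n)).invertibleToMatrix b
  refine ⟨(Pi.basisFun R (Fin n)).toMatrix b, isUnit_of_invertible _, fun i j hij => ?_⟩
  rw [← hb i j hij, ← LinearMap.BilinForm.toMatrix_apply b,
    ← LinearMap.BilinForm.toMatrix_mul_basis_toMatrix (Pi.basisFun R (Fin n)) b]
  simp [LinearMap.BilinForm.toMatrix_basisFun]

/-- An alternating matrix lifts along a surjective ring homomorphism to an alternating matrix. -/
theorem Matrix.exists_alternating_lift {n : ℕ} {R S : Type*} [CommRing R] [CommRing S]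
    {f : R →+* S} (hf : Function.Surjective f) (μ : Matrix (Fin n) (Fin n) S)
    (hskew : ∀ i j, μ i j = -μ j i) (hdiag : ∀ i, μ i i = 0) :
    ∃ M : Matrix (Fin n) (Fin n) R,
      M.map f = μ ∧ (∀ i j, M i j = -M j i) ∧ ∀ i, M i i = 0 := by
  choose g hg using hf
  refine ⟨.of fun i j => if i < j then g (μ i j) else if j < i then -g (μ j i) else 0, ?_, ?_, ?_⟩
  · ext i j
    rcases lt_trichotomy i j with h | rfl | h
    · simp [h, hg]
    · simp [hdiag]
    · simp [h, h.not_gt, hg, hskew i j]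
  · intro i j
    rcases lt_trichotomy i j with h | rfl | h
    · simp [h, h.not_gt]
    · simp
    · simp [h, h.not_gt]
  · simp

theorem Matrix.isAlt_toBilin' {n R : Type*} [Fintype n] [LinearOrder n] [CommRing R]
    [IsAddTorsionFree R] {M : Matrix n n R} (hskew : ∀ i j, M i j = -M j i) :
    (Matrix.toBilin' M).IsAlt := by
  intro x
  rw [← self_eq_neg, Matrix.toBilin'_apply]
  conv_rhs => rw [Finset.sum_comm]
  simp only [← Finset.sum_neg_distrib]
  refine Finset.sum_congr rfl fun i _ => Finset.sum_congr rfl fun j _ => ?_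
  rw [hskew i j]
  ring

theorem stmt17 (n d : ℕ) (hd : 2 ≤ d) (μ : Matrix (Fin n) (Fin n) (ZMod d))
    (hskew : ∀ i j, μ i j = - μ j i) (hdiag : ∀ i, μ i i = 0) :
    -- μ is cogredient to a matrix in Darboux normal form: all entries of UᵀμU outside
    -- the 2×2 diagonal blocks {2t−1, 2t} (1-indexed), i.e. {2s, 2s+1} (0-indexed), vanish
    ∃ U : Matrix (Fin n) (Fin n) (ZMod d), IsUnit U ∧
      ∀ i j : Fin n, ¬(i ≠ j ∧ i.val / 2 = j.val / 2) →
        (U.transpose * μ * U) i j = 0 := by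
  obtain ⟨M, rfl, hM, -⟩ :=
    Matrix.exists_alternating_lift (f := Int.castRingHom (ZMod d)) ZMod.intCast_surjective μ
      hskew hdiag
  obtain ⟨U, hU, h⟩ := M.exists_isUnit_darboux (Matrix.isAlt_toBilin' hM)
  refine ⟨U.map (Int.castRingHom (ZMod d)), hU.map (Int.castRingHom (ZMod d)).mapMatrix,
    fun i j hij => ?_⟩
  rw [← Matrix.transpose_map, ← Matrix.map_mul, ← Matrix.map_mul, Matrix.map_apply, h i j hij,
    map_zero]
end
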